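/- For a nonzero φ ∈ J_{k,m}(O_K), let ϱ(φ) := min{α+β : χ_{α,β} ≢ 0} be the order of vanishing of φ at the origin. (i) If φ ∈ J_{k,1}(O_K) is nonzero, then ϱ(φ) ≤ 2 when k ≡ 2 (mod 4), and ϱ(φ) ≤ 4 when k ≡ 0 (mod 4). (ii) If φ ∈ J_{k,2}(O_K) is nonzero, then ϱ(φ) ≤ 5 when k ≡ 1 or 3 (mod 4), and ϱ(φ) ≤ 8 when k ≡ 0 or 2 (mod 4). -/

import Mathlib

noncomputable section

open Complex

/-- `τ` lies in the upper half plane. -/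
def UHP (τ : ℂ) : Prop := 0 < τ.im

/-- `eC w = exp(2 π i w)`. -/
def eC (w : ℂ) : ℂ := Complex.exp (2 * (Real.pi : ℂ) * Complex.I * w)

/-- Entries of a matrix in `SL(2, ℤ)`, as complex numbers. -/
def Ma (M : Matrix.SpecialLinearGroup (Fin 2) ℤ) : ℂ := ((M.1 0 0 : ℤ) : ℂ)
def Mb (M : Matrix.SpecialLinearGroup (Fin 2) ℤ) : ℂ := ((M.1 0 1 : ℤ) : ℂ)
def Mc (M : Matrix.SpecialLinearGroup (Fin 2) ℤ) : ℂ := ((M.1 1 0 : ℤ) : ℂ)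
def Md (M : Matrix.SpecialLinearGroup (Fin 2) ℤ) : ℂ := ((M.1 1 1 : ℤ) : ℂ)

/-- Hermitian Jacobi form of weight `k` and index `m` for the Hermitian Jacobi group over
`ℤ[i]`.  A form is a function `φ : ℂ → ℂ → ℂ → ℂ`, all conditions being imposed for `τ`
in the upper half plane.  Units `ε ∈ ℤ[i]ˣ = {1, -1, i, -i}`, and the elliptic variables
`λ = p + q i`, `μ = u + v i` range over `ℤ[i]`.  The Fourier expansion is indexed by
`n ∈ ℕ` and `r = (a + b i)/2 ∈ O_K^♯ = (i/2)ℤ[i]`, supported on `N(r) ≤ n m`,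
i.e. `a² + b² ≤ 4 n m`. -/
structure IsHJF (k m : ℕ) (φ : ℂ → ℂ → ℂ → ℂ) : Prop where
  holo : DifferentiableOn ℂ (fun p : ℂ × ℂ × ℂ => φ p.1 p.2.1 p.2.2) {p | UHP p.1}
  transf : ∀ ε : ℂ, ε ∈ ({1, -1, Complex.I, -Complex.I} : Set ℂ) →
    ∀ M : Matrix.SpecialLinearGroup (Fin 2) ℤ, ∀ τ z₁ z₂ : ℂ, UHP τ →
      φ ((Ma M * τ + Mb M) / (Mc M * τ + Md M))
        (ε * z₁ / (Mc M * τ + Md M))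
        ((starRingEnd ℂ) ε * z₂ / (Mc M * τ + Md M))
      = ε ^ k * (Mc M * τ + Md M) ^ k *
          eC ((m : ℂ) * Mc M * z₁ * z₂ / (Mc M * τ + Md M)) * φ τ z₁ z₂
  ellip : ∀ p q u v : ℤ, ∀ τ z₁ z₂ : ℂ, UHP τ →
      φ τ (z₁ + ((p : ℂ) + (q : ℂ) * Complex.I) * τ + ((u : ℂ) + (v : ℂ) * Complex.I))
          (z₂ + ((p : ℂ) - (q : ℂ) * Complex.I) * τ + ((u : ℂ) - (v : ℂ) * Complex.I))
      = eC (-(m : ℂ) * (((p : ℂ) ^ 2 + (q : ℂ) ^ 2) * τ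
          + ((p : ℂ) - (q : ℂ) * Complex.I) * z₁
          + ((p : ℂ) + (q : ℂ) * Complex.I) * z₂)) * φ τ z₁ z₂
  fourier : ∃ c : ℕ → ℤ → ℤ → ℂ,
      (∀ (n : ℕ) (a b : ℤ), 4 * (n : ℤ) * m < a ^ 2 + b ^ 2 → c n a b = 0) ∧
      ∀ τ z₁ z₂ : ℂ, UHP τ →
        HasSum (fun p : ℕ × ℤ × ℤ => c p.1 p.2.1 p.2.2 *
          eC ((p.1 : ℂ) * τ + (((p.2.1 : ℂ) + (p.2.2 : ℂ) * Complex.I) / 2) * z₁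
            + (((p.2.1 : ℂ) - (p.2.2 : ℂ) * Complex.I) / 2) * z₂)) (φ τ z₁ z₂)

/-- Classical Jacobi form of weight `k` and index `m` for `SL(2,ℤ) ⋉ ℤ²`. -/
structure IsJF (k m : ℕ) (φ : ℂ → ℂ → ℂ) : Prop where
  holo : DifferentiableOn ℂ (fun p : ℂ × ℂ => φ p.1 p.2) {p | UHP p.1}
  transf : ∀ M : Matrix.SpecialLinearGroup (Fin 2) ℤ, ∀ τ z : ℂ, UHP τ →
      φ ((Ma M * τ + Mb M) / (Mc M * τ + Md M)) (z / (Mc M * τ + Md M))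
      = (Mc M * τ + Md M) ^ k *
          eC ((m : ℂ) * Mc M * z ^ 2 / (Mc M * τ + Md M)) * φ τ z
  ellip : ∀ p q : ℤ, ∀ τ z : ℂ, UHP τ →
      φ τ (z + (p : ℂ) * τ + (q : ℂ))
      = eC (-(m : ℂ) * ((p : ℂ) ^ 2 * τ + 2 * (p : ℂ) * z)) * φ τ z
  fourier : ∃ c : ℕ → ℤ → ℂ,
      (∀ (n : ℕ) (r : ℤ), 4 * (n : ℤ) * m < r ^ 2 → c n r = 0) ∧
      ∀ τ z : ℂ, UHP τ →
        HasSum (fun p : ℕ × ℤ => c p.1 p.2 * eC ((p.1 : ℂ) * τ + (p.2 : ℂ) * z)) (φ τ z)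

/-- Modular form of weight `k` for `SL(2,ℤ)`. -/
structure IsMF (k : ℕ) (f : ℂ → ℂ) : Prop where
  holo : DifferentiableOn ℂ f {τ | UHP τ}
  transf : ∀ M : Matrix.SpecialLinearGroup (Fin 2) ℤ, ∀ τ : ℂ, UHP τ →
      f ((Ma M * τ + Mb M) / (Mc M * τ + Md M)) = (Mc M * τ + Md M) ^ k * f τ
  bounded : ∃ A B : ℝ, ∀ τ : ℂ, B ≤ τ.im → ‖f τ‖ ≤ A

/-- Cusp form of weight `k` for `SL(2,ℤ)`. -/
structure IsCF (k : ℕ) (f : ℂ → ℂ) : Prop where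
  holo : DifferentiableOn ℂ f {τ | UHP τ}
  transf : ∀ M : Matrix.SpecialLinearGroup (Fin 2) ℤ, ∀ τ : ℂ, UHP τ →
      f ((Ma M * τ + Mb M) / (Mc M * τ + Md M)) = (Mc M * τ + Md M) ^ k * f τ
  decay : ∀ ε : ℝ, 0 < ε → ∃ B : ℝ, ∀ τ : ℂ, B ≤ τ.im → ‖f τ‖ ≤ ε

/-- `M_w(SL(2,ℤ), ω̄)` for the character `ω` of `SL(2,ℤ)` with `ω(T) = ω(S) = i`:
holomorphic functions on the upper half plane, bounded at infinity, with
`f|_w T = -i f` and `f|_w S = -i f`. -/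
structure IsMFOmegaBar (w : ℕ) (f : ℂ → ℂ) : Prop where
  holo : DifferentiableOn ℂ f {τ | UHP τ}
  transT : ∀ τ : ℂ, UHP τ → f (τ + 1) = -Complex.I * f τ
  transS : ∀ τ : ℂ, UHP τ → f (-1 / τ) = -Complex.I * τ ^ w * f τ
  bounded : ∃ A B : ℝ, ∀ τ : ℂ, B ≤ τ.im → ‖f τ‖ ≤ A

/-- Hermitian theta function `θ^H_{m,s}` of index `m` with characteristic
`s = (a + b i)/2 ∈ O_K^♯`; the sum is over `r = s + m (g₁ + g₂ i) ∈ s + m ℤ[i]`. -/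
def thetaH (m : ℕ) (a b : ℤ) (τ z₁ z₂ : ℂ) : ℂ :=
  ∑' g : ℤ × ℤ,
    eC ((((a : ℂ) + 2 * m * g.1) ^ 2 + ((b : ℂ) + 2 * m * g.2) ^ 2) / (4 * m) * τ
      + (((a : ℂ) + 2 * m * g.1) + ((b : ℂ) + 2 * m * g.2) * Complex.I) / 2 * z₁
      + (((a : ℂ) + 2 * m * g.1) - ((b : ℂ) + 2 * m * g.2) * Complex.I) / 2 * z₂)

/-- Classical theta function `θ_{m,μ}(τ,z) = Σ_{r ≡ μ mod 2m} e(r²τ/(4m) + r z)`. -/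
def thetaJ (m : ℕ) (μ : ℤ) (τ z : ℂ) : ℂ :=
  ∑' g : ℤ, eC (((μ : ℂ) + 2 * m * g) ^ 2 / (4 * m) * τ + ((μ : ℂ) + 2 * m * g) * z)

/-- `h` is the family of theta components of `φ` (for index `m`): the `h_{a,b}` depend
only on `(a, b) mod 2m` and `φ = Σ_{s ∈ O_K^♯ / m O_K} h_s θ^H_{m,s}`. -/
def HasThetaDecomp (m : ℕ) (φ : ℂ → ℂ → ℂ → ℂ) (h : ℤ → ℤ → ℂ → ℂ) : Prop :=
  (∀ (a b : ℤ) (τ : ℂ), h (a + 2 * m) b τ = h a b τ ∧ h a (b + 2 * m) τ = h a b τ) ∧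
  ∀ τ z₁ z₂ : ℂ, UHP τ →
    φ τ z₁ z₂ = ∑ a ∈ Finset.range (2 * m), ∑ b ∈ Finset.range (2 * m),
      h (a : ℤ) (b : ℤ) τ * thetaH m (a : ℤ) (b : ℤ) τ z₁ z₂

/-- `ϑ₀(τ) = Σ_{r ∈ ℤ} e(r² τ)`. -/
def theta0C (τ : ℂ) : ℂ := ∑' r : ℤ, eC ((r : ℂ) ^ 2 * τ)

/-- `ϑ₁(τ) = Σ_{r odd} e(r² τ / 4)`. -/
def theta1C (τ : ℂ) : ℂ := ∑' r : ℤ, eC ((2 * (r : ℂ) + 1) ^ 2 * τ / 4)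

/-- `ξ = ϑ₁ ϑ₀' − ϑ₀ ϑ₁'`. -/
def xiC (τ : ℂ) : ℂ := theta1C τ * deriv theta0C τ - theta0C τ * deriv theta1C τ

/-- Taylor coefficient `χ_{α,β}(τ)` of `φ(τ, z₁, z₂)` around `z₁ = z₂ = 0`. -/
def chiHJF (φ : ℂ → ℂ → ℂ → ℂ) (α β : ℕ) (τ : ℂ) : ℂ :=
  (1 / ((α.factorial : ℂ) * (β.factorial : ℂ))) *
    iteratedDeriv α (fun z₁ => iteratedDeriv β (fun z₂ => φ τ z₁ z₂) 0) 0

/-- `D₀ : J_{k,m} → M_k`, `ψ ↦ ψ(·, 0)`. -/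
def D0J (ψ : ℂ → ℂ → ℂ) : ℂ → ℂ := fun τ => ψ τ 0

/-- `D₂ : J_{k,m} → S_{k+2}`, `D₂ψ = (2k/(2πi)²) ψ₂ − (2m/(2πi)) ψ₀'`, where `ψ_ν` are
the Taylor coefficients of `ψ` around `z = 0`. -/
def D2J (k m : ℕ) (ψ : ℂ → ℂ → ℂ) : ℂ → ℂ := fun τ =>
  (2 * (k : ℂ) / (2 * (Real.pi : ℂ) * Complex.I) ^ 2) *
      ((1 / 2) * iteratedDeriv 2 (fun z => ψ τ z) 0)
    - (2 * (m : ℂ) / (2 * (Real.pi : ℂ) * Complex.I)) * deriv (fun t => ψ t 0) τ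

/-- Normalized Eisenstein series `E₄`. -/
def E4C (τ : ℂ) : ℂ :=
  1 + 240 * ∑' n : ℕ, ((ArithmeticFunction.sigma 3) n : ℂ) * eC ((n : ℂ) * τ)

/-- Normalized Eisenstein series `E₆`. -/
def E6C (τ : ℂ) : ℂ :=
  1 - 504 * ∑' n : ℕ, ((ArithmeticFunction.sigma 5) n : ℂ) * eC ((n : ℂ) * τ)

/-- `f` agrees on the upper half plane with a polynomial in `E₄` and `E₆²` that is
homogeneous of weight `k - v`, i.e. supported on `4a + 12b + v = k`. -/
def IsE4E6sqPoly (v k : ℕ) (f : ℂ → ℂ) : Prop :=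
  ∃ lam : ℕ × ℕ → ℂ, ∀ τ : ℂ, UHP τ →
    f τ = ∑ p ∈ (Finset.range (k + 1) ×ˢ Finset.range (k + 1)).filter
        (fun p => 4 * p.1 + 12 * p.2 + v = k),
      lam p * E4C τ ^ p.1 * E6C τ ^ (2 * p.2)

/-- The slash action `φ|_{k,m} M` of `M ∈ SL(2,ℤ)` on functions `ℂ → ℂ → ℂ → ℂ`. -/
def slashHJF (k m : ℕ) (φ : ℂ → ℂ → ℂ → ℂ) (M : Matrix.SpecialLinearGroup (Fin 2) ℤ)
    (τ z₁ z₂ : ℂ) : ℂ :=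
  ((Mc M * τ + Md M) ^ k)⁻¹ *
    eC (-(m : ℂ) * Mc M * z₁ * z₂ / (Mc M * τ + Md M)) *
    φ ((Ma M * τ + Mb M) / (Mc M * τ + Md M)) (z₁ / (Mc M * τ + Md M)) (z₂ / (Mc M * τ + Md M))

/-- Hermitian Jacobi form of weight `k` and index `m` for the congruence subgroup `Γ₀(N)`,
with at each cusp a Fourier expansion supported on `(n, r) ∈ ℚ_{≥0} × O_K^♯`
with `N(r) ≤ n m`. -/
structure IsHJFLevel (k m N : ℕ) (φ : ℂ → ℂ → ℂ → ℂ) : Prop where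
  holo : DifferentiableOn ℂ (fun p : ℂ × ℂ × ℂ => φ p.1 p.2.1 p.2.2) {p | UHP p.1}
  transf : ∀ ε : ℂ, ε ∈ ({1, -1, Complex.I, -Complex.I} : Set ℂ) →
    ∀ M : Matrix.SpecialLinearGroup (Fin 2) ℤ, (N : ℤ) ∣ M.1 1 0 →
    ∀ τ z₁ z₂ : ℂ, UHP τ →
      φ ((Ma M * τ + Mb M) / (Mc M * τ + Md M))
        (ε * z₁ / (Mc M * τ + Md M))
        ((starRingEnd ℂ) ε * z₂ / (Mc M * τ + Md M))
      = ε ^ k * (Mc M * τ + Md M) ^ k *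
          eC ((m : ℂ) * Mc M * z₁ * z₂ / (Mc M * τ + Md M)) * φ τ z₁ z₂
  ellip : ∀ p q u v : ℤ, ∀ τ z₁ z₂ : ℂ, UHP τ →
      φ τ (z₁ + ((p : ℂ) + (q : ℂ) * Complex.I) * τ + ((u : ℂ) + (v : ℂ) * Complex.I))
          (z₂ + ((p : ℂ) - (q : ℂ) * Complex.I) * τ + ((u : ℂ) - (v : ℂ) * Complex.I))
      = eC (-(m : ℂ) * (((p : ℂ) ^ 2 + (q : ℂ) ^ 2) * τ
          + ((p : ℂ) - (q : ℂ) * Complex.I) * z₁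
          + ((p : ℂ) + (q : ℂ) * Complex.I) * z₂)) * φ τ z₁ z₂
  cusp : ∀ M : Matrix.SpecialLinearGroup (Fin 2) ℤ,
      ∃ c : ℚ → ℤ → ℤ → ℂ,
        (∀ (n : ℚ) (a b : ℤ),
          ¬ (0 ≤ n ∧ ((a : ℚ) ^ 2 + (b : ℚ) ^ 2) ≤ 4 * n * m) → c n a b = 0) ∧
        ∀ τ z₁ z₂ : ℂ, UHP τ →
          HasSum (fun p : ℚ × ℤ × ℤ => c p.1 p.2.1 p.2.2 *
            eC ((p.1 : ℂ) * τ + (((p.2.1 : ℂ) + (p.2.2 : ℂ) * Complex.I) / 2) * z₁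
              + (((p.2.1 : ℂ) - (p.2.2 : ℂ) * Complex.I) / 2) * z₂))
            (slashHJF k m φ M τ z₁ z₂)

/-- Theta constant `x`. -/
def thConstX (τ : ℂ) : ℂ := ∑' n : ℤ, eC ((n : ℂ) ^ 2 * τ / 2)

/-- Theta constant `y`. -/
def thConstY (τ : ℂ) : ℂ := ∑' n : ℤ, (-1 : ℂ) ^ n * eC ((n : ℂ) ^ 2 * τ / 2)

/-- Theta constant `z`. -/
def thConstZ (τ : ℂ) : ℂ := ∑' n : ℤ, eC (((n : ℂ) + 1 / 2) ^ 2 * τ / 2)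


lemma eC_add (a b : ℂ) : eC (a + b) = eC a * eC b := by
  simp only [eC, mul_add, Complex.exp_add]

lemma eC_ne (a : ℂ) : eC a ≠ 0 := Complex.exp_ne_zero _

lemma eC_zero : eC 0 = 1 := by simp [eC]

lemma eC_neg (a : ℂ) : eC (-a) = (eC a)⁻¹ := by
  simp only [eC, mul_neg, Complex.exp_neg]

lemma eC_sub (a b : ℂ) : eC (a - b) = eC a / eC b := by
  rw [sub_eq_add_neg, eC_add, eC_neg, div_eq_mul_inv]

lemma eC_diff : Differentiable ℂ eC := by
  unfold eC; fun_prop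

lemma eC_one : eC 1 = 1 := by
  simp only [eC, mul_one]; exact Complex.exp_two_pi_mul_I

lemma eC_nat (n : ℕ) (a : ℂ) : eC (n * a) = eC a ^ n := by
  simp only [eC]; rw [← Complex.exp_nat_mul]; ring_nf

lemma eC_eq_one {a : ℂ} (h : eC a = 1) : ∃ n : ℤ, a = n := by
  obtain ⟨n, hn⟩ := Complex.exp_eq_one_iff.1 h
  refine ⟨n, ?_⟩
  have : (2 * (Real.pi : ℂ) * Complex.I) ≠ 0 := Complex.two_pi_I_ne_zero
  apply mul_left_cancel₀ this
  rw [hn]; ring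

lemma eC_deriv (a : ℂ) : HasDerivAt eC (2 * (Real.pi : ℂ) * Complex.I * eC a) a := by
  unfold eC
  have := ((hasDerivAt_id a).const_mul (2 * (Real.pi : ℂ) * Complex.I)).cexp
  simpa [mul_comm] using this

lemma eC_norm_lt {τ : ℂ} (h : 0 < τ.im) : ‖eC τ‖ < 1 := by
  rw [eC, Complex.norm_exp]
  simp
  positivity

/-- product -/
def AP (q w : ℂ) : ℂ := ∏' n : ℕ, (1 + -(q ^ n * w))

lemma AP_summ {q : ℂ} (hq : ‖q‖ < 1) (w : ℂ) : Summable fun n : ℕ => ‖-(q ^ n * w)‖ := by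
  simp only [norm_neg, norm_mul, norm_pow]
  exact (summable_geometric_of_lt_one (norm_nonneg _) hq).mul_right _

lemma AP_rec {q : ℂ} (hq : ‖q‖ < 1) (w : ℂ) : AP q w = (1 - w) * AP q (q * w) := by
  unfold AP
  rw [tprod_eq_zero_mul']
  · simp only [pow_zero, one_mul, ← sub_eq_add_neg, pow_succ, mul_assoc]
  · have := multipliable_one_add_of_summable (AP_summ hq (q * w))
    simpa [pow_succ, mul_assoc] using this

lemma AP_zero {q : ℂ} (hq : ‖q‖ < 1) {w : ℂ} (h : AP q w = 0) : ∃ n : ℕ, q ^ n * w = 1 := by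
  by_contra! hc
  refine tprod_one_add_ne_zero_of_summable (f := fun n : ℕ => -(q ^ n * w)) ?_ (AP_summ hq w) h
  intro n h'
  apply hc n
  linear_combination -h'

lemma AP_diff {q : ℂ} (hq : ‖q‖ < 1) : Differentiable ℂ (AP q) := by
  have : MultipliableLocallyUniformlyOn (fun (n : ℕ) w ↦ 1 + -(q ^ n * w)) (Set.univ : Set ℂ) := by
    use AP q
    apply hasProdLocallyUniformlyOn_of_forall_compact isOpen_univ
    intro K hK hcK
    obtain ⟨R, hR⟩ := hcK.isBounded.exists_norm_le
    refine ((summable_geometric_of_lt_one (norm_nonneg _) hq).mul_right R).hasProdUniformlyOn_nat_one_add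
      hcK (.of_forall fun n x hx ↦ ?_) (fun _ ↦ by fun_prop)
    simp only [norm_neg, norm_mul, norm_pow]
    gcongr
    exact hR x hx
  have h := this.hasProdLocallyUniformlyOn.differentiableOn
    (.of_forall fun _ ↦ by simpa [Finset.prod_fn] using
      DifferentiableOn.finsetProd (fun _ _ ↦ by fun_prop)) isOpen_univ
  exact differentiableOn_univ.1 h

/-- theta-like function with simple zeros at the lattice -/
def PT (τ u : ℂ) : ℂ := AP (eC τ) (eC u) * AP (eC τ) (eC (τ - u))

lemma PT_diff {τ : ℂ} (h : 0 < τ.im) : Differentiable ℂ (PT τ) := by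
  have h1 := AP_diff (eC_norm_lt h)
  have h2 := eC_diff
  unfold PT
  fun_prop

lemma PT_one (τ u : ℂ) : PT τ (u + 1) = PT τ u := by
  unfold PT
  rw [← sub_sub, eC_add, eC_sub _ 1, eC_one]; simp

lemma PT_tau {τ : ℂ} (h : 0 < τ.im) (u : ℂ) : PT τ (u + τ) = -eC (-u) * PT τ u := by
  unfold PT
  have h1 := AP_rec (eC_norm_lt h) (eC u)
  have h2 := AP_rec (eC_norm_lt h) (eC (-u))
  rw [← eC_add] at h1 h2
  have e1 : τ - (u + τ) = -u := by ring
  rw [e1, h1, h2, add_comm u τ, ← sub_eq_add_neg τ u]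
  have : eC (-u) * eC u = 1 := by rw [← eC_add]; simp [eC_zero]
  linear_combination (-1 * AP (eC τ) (eC (τ + u)) * AP (eC τ) (eC (τ - u))) * this

lemma PT_zero {τ : ℂ} (h : 0 < τ.im) {u : ℂ} (hu : PT τ u = 0) :
    ∃ k l : ℤ, u = k * τ + l := by
  rcases mul_eq_zero.1 hu with h1 | h1
  · obtain ⟨n, hn⟩ := AP_zero (eC_norm_lt h) h1
    rw [← eC_nat, ← eC_add] at hn
    obtain ⟨l, hl⟩ := eC_eq_one hn
    exact ⟨-n, l, by push_cast; linear_combination hl⟩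
  · obtain ⟨n, hn⟩ := AP_zero (eC_norm_lt h) h1
    rw [← eC_nat, ← eC_add] at hn
    obtain ⟨l, hl⟩ := eC_eq_one hn
    exact ⟨n + 1, -l, by push_cast; linear_combination -hl⟩

lemma AP_q_ne {q : ℂ} (hq : ‖q‖ < 1) : AP q q ≠ 0 := by
  intro h
  obtain ⟨n, hn⟩ := AP_zero hq h
  rw [← pow_succ] at hn
  have := congrArg norm hn
  rw [norm_pow, norm_one] at this
  have h2 := pow_lt_one₀ (norm_nonneg q) hq (Nat.succ_ne_zero n)
  exact absurd this h2.ne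

lemma PT_at_zero {τ : ℂ} (h : 0 < τ.im) : PT τ 0 = 0 := by
  unfold PT
  rw [AP_rec (eC_norm_lt h), eC_zero]; simp

lemma PT_deriv_zero {τ : ℂ} (h : 0 < τ.im) : deriv (PT τ) 0 ≠ 0 := by
  have hA := AP_diff (eC_norm_lt h)
  have e : PT τ = fun u => (1 - eC u) * (AP (eC τ) (eC τ * eC u) * AP (eC τ) (eC (τ - u))) := by
    funext u
    unfold PT
    rw [AP_rec (eC_norm_lt h) (eC u)]; ring
  have d1 : HasDerivAt (fun u => 1 - eC u) (-(2 * (Real.pi : ℂ) * Complex.I * eC 0)) 0 := by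
    simpa using (eC_deriv 0).const_sub 1
  have d2 : DifferentiableAt ℂ (fun u => AP (eC τ) (eC τ * eC u) * AP (eC τ) (eC (τ - u))) 0 := by
    have h2 := eC_diff
    fun_prop
  have := (d1.mul d2.hasDerivAt).deriv
  have e' : PT τ = (fun u => 1 - eC u) * (fun u => AP (eC τ) (eC τ * eC u) * AP (eC τ) (eC (τ - u))) := e
  rw [e', this]
  simp [eC_zero, AP_q_ne (eC_norm_lt h), Real.pi_ne_zero]

/-- `g` is quasi-periodic -/
def QP (τ C : ℂ) (n : ℤ) (g : ℂ → ℂ) : Prop :=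
  Differentiable ℂ g ∧ (∀ u, g (u + 1) = g u) ∧ ∀ u, g (u + τ) = C * eC (-n * u) * g u

lemma QP_PT {τ : ℂ} (h : 0 < τ.im) : QP τ (-1) 1 (PT τ) :=
  ⟨PT_diff h, PT_one τ, fun u => by rw [PT_tau h]; simp⟩

lemma QP_inv {τ C : ℂ} {n : ℤ} {g : ℂ → ℂ} (h : QP τ C n g) (hC : C ≠ 0) (u : ℂ) :
    g u = C⁻¹ * eC (n * u) * g (u + τ) := by
  rw [h.2.2 u, neg_mul, eC_neg]
  field_simp [eC_ne]

lemma int_shift {s : ℂ} {Q : ℂ → Prop} (hs : ∀ u, Q u ↔ Q (u + s)) (k : ℤ) (u : ℂ) :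
    Q u ↔ Q (k * s + u) := by
  induction k with
  | zero => simp
  | succ n ih => rw [ih, hs]; push_cast; ring_nf
  | pred n ih =>
    rw [ih, hs (((-n - 1 : ℤ) : ℂ) * s + u)]; push_cast; ring_nf

lemma lat_shift {τ : ℂ} {Q : ℂ → Prop} (h1 : ∀ u, Q u ↔ Q (u + 1)) (h2 : ∀ u, Q u ↔ Q (u + τ))
    (k l : ℤ) (u : ℂ) : Q u ↔ Q (k * τ + l + u) := by
  rw [int_shift h1 l u, int_shift h2 k]; ring_nf

lemma QP_zero_shift {τ C : ℂ} {n : ℤ} {g : ℂ → ℂ} (h : QP τ C n g) (hC : C ≠ 0)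
    (k l : ℤ) (u : ℂ) : g u = 0 ↔ g (k * τ + l + u) = 0 := by
  apply lat_shift (Q := fun u => g u = 0)
  · intro u; rw [h.2.1]
  · intro u; rw [h.2.2]; simp [hC, eC_ne]

lemma QP_deriv_shift {τ C : ℂ} {n : ℤ} {g : ℂ → ℂ} (h : QP τ C n g) (hC : C ≠ 0)
    (k l : ℤ) (u : ℂ) : (g u = 0 ∧ deriv g u ≠ 0) ↔
      (g (k * τ + l + u) = 0 ∧ deriv g (k * τ + l + u) ≠ 0) := by
  apply lat_shift (Q := fun u => g u = 0 ∧ deriv g u ≠ 0)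
  · intro u
    rw [← deriv_comp_add_const]
    simp only [h.2.1]
  · intro u
    rw [← deriv_comp_add_const]
    simp only [h.2.2]
    have d : DifferentiableAt ℂ (fun u => C * eC (-n * u)) u := by
      have := eC_diff; fun_prop
    have : deriv (fun u => C * eC (-n * u) * g u) u
        = deriv (fun u => C * eC (-n * u)) u * g u + C * eC (-n * u) * deriv g u :=
      deriv_fun_mul d (h.1 u)
    rw [this]
    constructor
    · rintro ⟨a, b⟩; simp [a, b, hC, eC_ne]
    · rintro ⟨a, b⟩
      have : g u = 0 := by simpa [hC, eC_ne] using a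
      simpa [this, hC, eC_ne] using b

lemma PT_simple {τ : ℂ} (h : 0 < τ.im) {u : ℂ} (hu : PT τ u = 0) : deriv (PT τ) u ≠ 0 := by
  obtain ⟨k, l, rfl⟩ := PT_zero h hu
  have := (QP_deriv_shift (QP_PT h) (by simp) k l 0).1 ⟨PT_at_zero h, PT_deriv_zero h⟩
  simpa using this.2

/-- division lemma -/
lemma ent_div {g p : ℂ → ℂ} (hg : Differentiable ℂ g) (hp : Differentiable ℂ p)
    (H : ∀ u, p u = 0 → g u = 0 ∧ deriv p u ≠ 0) :
    ∃ h : ℂ → ℂ, Differentiable ℂ h ∧ ∀ u, g u = p u * h u := by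
  classical
  refine ⟨fun u => if p u = 0 then deriv g u / deriv p u else g u / p u, ?_, ?_⟩
  · intro u
    by_cases hu : p u = 0
    · obtain ⟨hg0, hp0⟩ := H u hu
      have dg : Differentiable ℂ (dslope g u) := by
        rw [← differentiableOn_univ]
        exact (Complex.differentiableOn_dslope Filter.univ_mem).2 hg.differentiableOn
      have dp : Differentiable ℂ (dslope p u) := by
        rw [← differentiableOn_univ]
        exact (Complex.differentiableOn_dslope Filter.univ_mem).2 hp.differentiableOn
      have hp1 : dslope p u u ≠ 0 := by rwa [dslope_same]
      have ev : ∀ᶠ v in nhds u, dslope p u v ≠ 0 :=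
        dp.continuous.continuousAt.eventually_ne hp1
      have hd : DifferentiableAt ℂ (fun v => dslope g u v / dslope p u v) u :=
        (dg u).div (dp u) hp1
      refine hd.congr_of_eventuallyEq ?_
      filter_upwards [ev] with v hv
      by_cases hvu : v = u
      · subst hvu; simp [hu, dslope_same]
      · have e1 : p v = (v - u) * dslope p u v := by
          have := sub_smul_dslope p u v
          simp only [smul_eq_mul, hu, sub_zero] at this; exact this.symm
        have e2 : g v = (v - u) * dslope g u v := by
          have := sub_smul_dslope g u v
          simp only [smul_eq_mul, hg0, sub_zero] at this; exact this.symm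
        have hvu' : v - u ≠ 0 := sub_ne_zero.2 hvu
        have : p v ≠ 0 := by rw [e1]; exact mul_ne_zero hvu' hv
        rw [if_neg this, e1, e2]
        field_simp
    · have hd : DifferentiableAt ℂ (fun v => g v / p v) u := (hg u).div (hp u) hu
      refine hd.congr_of_eventuallyEq ?_
      filter_upwards [hp.continuous.continuousAt.eventually_ne hu] with v hv
      simp [hv]
  · intro u
    by_cases hu : p u = 0
    · simp [hu, (H u hu).1]
    · simp only [if_neg hu]; field_simp

lemma ent_mul_zero {p h : ℂ → ℂ} (hp : Differentiable ℂ p) (hh : Differentiable ℂ h)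
    (hne : ∃ u, p u ≠ 0) (H : ∀ u, p u * h u = 0) : ∀ u, h u = 0 := by
  obtain ⟨u₀, hu₀⟩ := hne
  have ha : AnalyticOnNhd ℂ h Set.univ := fun x _ => hh.analyticAt x
  have : h =ᶠ[nhds u₀] 0 := by
    filter_upwards [hp.continuous.continuousAt.eventually_ne hu₀] with v hv
    exact (mul_eq_zero.1 (H v)).resolve_left hv
  intro u
  have := ha.eqOn_zero_of_preconnected_of_eventuallyEq_zero isPreconnected_univ (Set.mem_univ u₀) this
  exact this (Set.mem_univ u)

lemma QP_div {τ C C' : ℂ} {n n' : ℤ} {g p : ℂ → ℂ} (hg : QP τ C n g) (hp : QP τ C' n' p)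
    (hC : C' ≠ 0) (H : ∀ u, p u = 0 → g u = 0 ∧ deriv p u ≠ 0) (hne : ∃ u, p u ≠ 0) :
    ∃ h : ℂ → ℂ, QP τ (C / C') (n - n') h ∧ ∀ u, g u = p u * h u := by
  obtain ⟨h, hd, he⟩ := ent_div hg.1 hp.1 H
  refine ⟨h, ⟨hd, fun u => ?_, fun u => ?_⟩, he⟩
  · have := ent_mul_zero (h := fun u => h (u + 1) - h u) hp.1 (by fun_prop) hne (fun u => by
      have h1 := hg.2.1 u
      rw [he, he, hp.2.1] at h1
      linear_combination h1) u
    linear_combination this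
  · have := ent_mul_zero (h := fun u => h (u + τ) - C / C' * eC (-(n - n' : ℤ) * u) * h u) hp.1
      (by have := eC_diff; fun_prop) hne (fun u => by
      have h1 := hg.2.2 u
      rw [he, he, hp.2.2] at h1
      have e : eC (-n * u) = eC (-n' * u) * eC (-(n - n' : ℤ) * u) := by
        rw [← eC_add]; push_cast; ring_nf
      rw [e] at h1
      have hne := eC_ne (-n' * u)
      apply mul_left_cancel₀ (mul_ne_zero hC hne)
      have e2 : C / C' * C' = C := div_mul_cancel₀ _ hC
      linear_combination h1 - eC (-n' * u) * p u * eC (-(n - n' : ℤ) * u) * h u * e2) u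
    linear_combination this

lemma PT_ne {τ : ℂ} (h : 0 < τ.im) : ∃ u, PT τ u ≠ 0 := by
  by_contra! hc
  have : PT τ = fun _ => 0 := funext hc
  have h2 := PT_deriv_zero h
  rw [this] at h2; simp at h2

lemma QP_mul {τ C C' : ℂ} {n n' : ℤ} {g p : ℂ → ℂ} (hg : QP τ C n g) (hp : QP τ C' n' p) :
    QP τ (C * C') (n + n') (fun u => g u * p u) := by
  refine ⟨hg.1.mul hp.1, fun u => by simp only [hg.2.1, hp.2.1], fun u => ?_⟩
  simp only [hg.2.2, hp.2.2]
  have e : eC (-(n + n' : ℤ) * u) = eC (-n * u) * eC (-n' * u) := by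
    rw [← eC_add]; push_cast; ring_nf
  rw [e]; ring

/-- doubly periodic entire functions are constant -/
lemma dp_const {τ : ℂ} (h : 0 < τ.im) {g : ℂ → ℂ} (hg : QP τ 1 0 g) (u v : ℂ) : g u = g v := by
  refine hg.1.apply_eq_apply_of_bounded ?_ u v
  have hc : IsCompact ((fun p : ℝ × ℝ => (p.1 : ℂ) * τ + p.2) '' (Set.Icc 0 1 ×ˢ Set.Icc 0 1)) :=
    (isCompact_Icc.prod isCompact_Icc).image (by fun_prop)
  refine (hc.image hg.1.continuous).isBounded.subset ?_
  rintro _ ⟨w, rfl⟩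
  set y := w.im / τ.im with hy
  set x := (w - y * τ).re with hx
  have hw : w = y * τ + x := by
    apply Complex.ext
    · simp [hx]
    · simp [hy]; field_simp
  refine ⟨(Int.fract y : ℝ) * τ + (Int.fract x : ℝ), ⟨(Int.fract y, Int.fract x), ⟨⟨Int.fract_nonneg _, (Int.fract_lt_one _).le⟩, ⟨Int.fract_nonneg _, (Int.fract_lt_one _).le⟩⟩, rfl⟩, ?_⟩
  have := (lat_shift (Q := fun z => g z = g w) (τ := τ) (fun u => by rw [hg.2.1])
    (fun u => by rw [hg.2.2]; simp [eC_zero]) ⌊y⌋ ⌊x⌋ ((Int.fract y : ℝ) * τ + (Int.fract x : ℝ))).2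
  apply this
  congr 1
  conv_rhs => rw [hw]
  have e1 : (y : ℂ) = ⌊y⌋ + (Int.fract y : ℝ) := by
    have := Int.floor_add_fract y
    exact_mod_cast this.symm
  have e2 : (x : ℂ) = ⌊x⌋ + (Int.fract x : ℝ) := by
    have := Int.floor_add_fract x
    exact_mod_cast this.symm
  linear_combination (-τ) * e1 - e2

/-- degree `-1` -/
lemma QP_neg_one {τ C : ℂ} (h : 0 < τ.im) (hC : C ≠ 0) {g : ℂ → ℂ} (hg : QP τ C (-1) g) (u : ℂ) :
    g u = 0 := by
  obtain ⟨b, hb⟩ : ∃ b, eC b = -C⁻¹ := by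
    refine ⟨Complex.log (-C⁻¹) / (2 * (Real.pi : ℂ) * Complex.I), ?_⟩
    unfold eC
    rw [mul_div_cancel₀ _ Complex.two_pi_I_ne_zero, Complex.exp_log]
    simpa using hC
  have hP : QP τ (C⁻¹) 1 (fun u => PT τ (u - b)) := by
    have hd := PT_diff h
    refine ⟨by fun_prop, fun u => ?_, fun u => ?_⟩
    · show PT τ (u + 1 - b) = PT τ (u - b)
      rw [← PT_one τ (u - b)]; ring_nf
    · show PT τ (u + τ - b) = _
      have : u + τ - b = (u - b) + τ := by ring
      rw [this, PT_tau h, neg_sub, sub_eq_add_neg, eC_add, hb]; simp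
  have hm := QP_mul hg hP
  rw [mul_inv_cancel₀ hC] at hm
  have hz : ∀ u, PT τ (u - b) * g u = 0 := by
    intro u
    have := dp_const h hm u b
    simp only [sub_self, PT_at_zero h, mul_zero] at this
    rw [mul_comm]; exact this
  refine ent_mul_zero hP.1 hg.1 ?_ hz u
  obtain ⟨w, hw⟩ := PT_ne h
  exact ⟨w + b, by simpa using hw⟩

/-- order bound at the origin -/
lemma QP_order {τ : ℂ} (h : 0 < τ.im) (n : ℕ) : ∀ {C : ℂ} (_ : C ≠ 0) {g : ℂ → ℂ}
    (_ : QP τ C ((n : ℤ) - 1) g) (_ : (n : ℕ∞) ≤ analyticOrderAt g 0), ∀ u, g u = 0 := by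
  induction n with
  | zero => intro C hC g hg _; exact QP_neg_one h hC (by simpa using hg)
  | succ n ih =>
    intro C hC g hg ho
    have h0 : g 0 = 0 := by
      rw [← (hg.1.analyticAt 0).analyticOrderAt_ne_zero]
      intro h'
      rw [h'] at ho
      simp at ho
    obtain ⟨g1, hg1, he⟩ := QP_div hg (QP_PT h) (by simp) (fun u hu => ⟨by
      obtain ⟨k, l, rfl⟩ := PT_zero h hu
      simpa using (QP_zero_shift hg hC k l 0).1 h0, PT_simple h hu⟩) (PT_ne h)
    have hgz : ∀ u, g1 u = 0 := by
      refine ih (C := C / -1) (by simpa using hC) (by convert hg1 using 1; push_cast; ring) ?_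
      have e : g = PT τ * g1 := funext he
      rw [e, analyticOrderAt_mul ((PT_diff h).analyticAt 0) (hg1.1.analyticAt 0)] at ho
      have hP : analyticOrderAt (PT τ) 0 = 1 := by
        have := ((PT_diff h).analyticAt 0).analyticOrderAt_sub_eq_one_of_deriv_ne_zero (PT_deriv_zero h)
        simpa [PT_at_zero h] using this
      rw [hP, add_comm 1] at ho
      push_cast at ho
      exact (ENat.add_le_add_iff_right ENat.one_ne_top).1 ho
    intro u
    rw [he, hgz, mul_zero]

lemma QP_negarg {τ C : ℂ} {n : ℤ} {g : ℂ → ℂ} (h : QP τ C n g) (hC : C ≠ 0)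
    (hCC : C * C = eC (-n * τ)) : QP τ C n (fun u => g (-u)) := by
  refine ⟨h.1.comp differentiable_neg, fun u => ?_, fun u => ?_⟩
  · have := h.2.1 (-(u + 1))
    show g (-(u + 1)) = g (-u)
    rw [← this]; ring_nf
  · have := h.2.2 (-(u + τ))
    have e : -(u + τ) + τ = -u := by ring
    rw [e] at this
    have e2 : eC (-n * u) * eC (-n * -(u + τ)) * eC (-n * τ) = 1 := by
      rw [← eC_add, ← eC_add, ← eC_zero]; ring_nf
    simp only [this]
    linear_combination (-g (-(u + τ))) * e2 - eC (-n * u) * eC (-n * -(u + τ)) * g (-(u + τ)) * hCC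

lemma QP_add {τ C : ℂ} {n : ℤ} {g p : ℂ → ℂ} (hg : QP τ C n g) (hp : QP τ C n p) (s : ℂ) :
    QP τ C n (fun u => g u + s * p u) := by
  have h1 := hg.1
  have h2 := hp.1
  refine ⟨by fun_prop, fun u => by simp only [hg.2.1, hp.2.1], fun u => ?_⟩
  simp only [hg.2.2, hp.2.2]; ring

lemma odd_zero {τ : ℂ} {m : ℕ} {g : ℂ → ℂ} (hg : QP τ (eC (-m * τ)) (2 * m) g)
    (hodd : ∀ u, g (-u) = -g u) (k l : ℤ) (u : ℂ) (hu : 2 * u = k * τ + l) : g u = 0 := by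
  have hC := eC_ne (-m * τ)
  have key : ∀ a b : ℤ, (a = 0 ∨ a = 1) → (b = 0 ∨ b = 1) → g ((a * τ + b) / 2) = 0 := by
    intro a b ha hb
    have self : ∀ x : ℂ, x = -x → x = 0 := fun x hx => by linear_combination hx / 2
    apply self
    rw [← hodd]
    have hb' : ∀ x : ℂ, g (x + b) = g x := by
      intro x
      rcases hb with rfl | rfl
      · simp
      · simpa using hg.2.1 x
    rcases ha with rfl | rfl
    · rw [← hb' (-_)]; push_cast; ring_nf
    · have e : (((1 : ℤ) : ℂ) * τ + b) / 2 = (-((((1 : ℤ) : ℂ) * τ + b) / 2) + b) + τ := by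
        push_cast; ring
      conv_lhs => rw [e]
      rw [hg.2.2, hb', ← eC_add]
      have e3 : eC (-(m : ℂ) * τ + -((2 * (m : ℤ) : ℤ) : ℂ) * (-((((1 : ℤ) : ℂ) * τ + b) / 2) + b)) = 1 := by
        have : (-(m : ℂ) * τ + -((2 * (m : ℤ) : ℤ) : ℂ) * (-((((1 : ℤ) : ℂ) * τ + b) / 2) + b))
            = -((m : ℂ) * b) := by push_cast; ring
        rw [this, eC_neg, eC_nat]
        rcases hb with rfl | rfl <;> simp [eC_zero, eC_one]
      rw [e3, one_mul]
  have hk := Int.emod_two_eq_zero_or_one k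
  have hl := Int.emod_two_eq_zero_or_one l
  have h1 := (QP_zero_shift hg hC (k / 2) (l / 2) _).1 (key (k % 2) (l % 2) hk hl)
  have ek : (k : ℂ) = 2 * (k / 2 : ℤ) + (k % 2 : ℤ) := by
    exact_mod_cast (Int.mul_ediv_add_emod k 2).symm
  have el : (l : ℂ) = 2 * (l / 2 : ℤ) + (l % 2 : ℤ) := by
    exact_mod_cast (Int.mul_ediv_add_emod l 2).symm
  convert h1 using 2
  linear_combination hu / 2 + ek * τ / 2 + el / 2

lemma odd_div {τ : ℂ} (h : 0 < τ.im) {m : ℕ} {g : ℂ → ℂ} (hg : QP τ (eC (-m * τ)) (2 * m) g)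
    (hodd : ∀ u, g (-u) = -g u) :
    ∃ h C, C ≠ 0 ∧ QP τ C (2 * m - 4) h ∧ ∀ u, g u = PT τ (2 * u) * h u := by
  have hd := PT_diff h
  have hP : QP τ (eC (-τ)) 4 (fun u => PT τ (2 * u)) := by
    refine ⟨by fun_prop, fun u => ?_, fun u => ?_⟩
    · show PT τ (2 * (u + 1)) = PT τ (2 * u)
      rw [← PT_one τ (2 * u), ← PT_one τ (2 * u + 1)]; ring_nf
    · show PT τ (2 * (u + τ)) = _ * PT τ (2 * u)
      have : 2 * (u + τ) = (2 * u + τ) + τ := by ring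
      rw [this, PT_tau h, PT_tau h]
      have e : eC (-τ) * eC (-(4 : ℤ) * u) = eC (-(2 * u + τ)) * eC (-(2 * u)) := by
        rw [← eC_add, ← eC_add]; push_cast; ring_nf
      rw [e]; ring
  have hder : ∀ u, deriv (fun u => PT τ (2 * u)) u = 2 * deriv (PT τ) (2 * u) := by
    intro u
    have := deriv_comp_mul_left (2 : ℂ) (PT τ) u
    simpa using this
  obtain ⟨f, hf, he⟩ := QP_div hg hP (eC_ne _) (fun u hu => ⟨by
    obtain ⟨k, l, hkl⟩ := PT_zero h hu
    exact odd_zero hg hodd k l u hkl, by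
    rw [hder]; exact mul_ne_zero two_ne_zero (PT_simple h hu)⟩) (by
      obtain ⟨w, hw⟩ := PT_ne h
      exact ⟨w / 2, by simpa [mul_div_cancel₀] using hw⟩)
  exact ⟨f, _, div_ne_zero (eC_ne _) (eC_ne _), hf, he⟩

lemma qodd_one {τ : ℂ} (h : 0 < τ.im) {g : ℂ → ℂ} (hg : QP τ (eC (-(1 : ℕ) * τ)) (2 * (1 : ℕ)) g)
    (hodd : ∀ u, g (-u) = -g u) (u : ℂ) : g u = 0 := by
  obtain ⟨f, C, hC, hf, he⟩ := odd_div h hg hodd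
  have h1 := QP_mul hf (QP_PT h)
  have h2 := QP_neg_one (C := C * -1) h (by simpa using hC) (by convert h1 using 1; norm_num)
  have h3 := ent_mul_zero (PT_diff h) hf.1 (PT_ne h) (fun u => by rw [mul_comm]; exact h2 u)
  rw [he, h3, mul_zero]

lemma qodd_two {τ : ℂ} (h : 0 < τ.im) {g : ℂ → ℂ} (hg : QP τ (eC (-(2 : ℕ) * τ)) (2 * (2 : ℕ)) g)
    (hodd : ∀ u, g (-u) = -g u) (h0 : deriv g 0 = 0) (u : ℂ) : g u = 0 := by
  obtain ⟨f, C, hC, hf, he⟩ := odd_div h hg hodd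
  have hd := PT_diff h
  have hder : deriv (fun u => PT τ (2 * u)) 0 = 2 * deriv (PT τ) 0 := by
    have := deriv_comp_mul_left (2 : ℂ) (PT τ) 0
    simpa using this
  have e : g = fun u => PT τ (2 * u) * f u := funext he
  have e2 : deriv (fun u => PT τ (2 * u) * f u) 0 = deriv (fun u => PT τ (2 * u)) 0 * f 0
      + PT τ (2 * 0) * deriv f 0 := deriv_fun_mul (by fun_prop) (hf.1 0)
  rw [e, e2, hder, mul_zero, PT_at_zero h, zero_mul, add_zero] at h0
  have hf0 : f 0 = 0 := by simpa [PT_deriv_zero h] using h0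
  have h3 := QP_order h 1 hC (g := f) (by convert hf using 1; norm_num) (by
    rw [natCast_le_analyticOrderAt_iff_iteratedDeriv_eq_zero (hf.1.analyticAt 0)]
    intro i hi
    obtain rfl : i = 0 := by omega
    simpa using hf0)
  rw [he, h3, mul_zero]

lemma ent_cd {g : ℂ → ℂ} (hg : Differentiable ℂ g) (n : ℕ∞) (x : ℂ) : ContDiffAt ℂ n g x :=
  hg.contDiff.contDiffAt

lemma iter_pm {g : ℂ → ℂ} (hg : Differentiable ℂ g) (s : ℂ) (i : ℕ) :
    iteratedDeriv i (fun u => g u + s * g (-u)) 0 = (1 + s * (-1) ^ i) * iteratedDeriv i g 0 := by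
  have h2 : Differentiable ℂ (fun u => g (-u)) := hg.comp differentiable_neg
  have := iteratedDeriv_fun_add (n := i) (x := (0 : ℂ)) (f := g) (g := fun u => s * g (-u))
    hg.contDiff.contDiffAt (h2.const_mul s).contDiff.contDiffAt
  rw [this, iteratedDeriv_const_mul_field, iteratedDeriv_comp_neg]
  simp; ring

lemma cc_m (τ : ℂ) (m : ℕ) : eC (-m * τ) * eC (-m * τ) = eC (-(2 * (m : ℤ) : ℤ) * τ) := by
  rw [← eC_add]; push_cast; ring_nf

lemma even_part {τ : ℂ} (h : 0 < τ.im) {m : ℕ} {g : ℂ → ℂ} (hg : QP τ (eC (-m * τ)) (2 * m) g)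
    (hi : ∀ i ≤ m, iteratedDeriv (2 * i) g 0 = 0) (u : ℂ) : g u + 1 * g (-u) = 0 := by
  have hp := QP_add hg (QP_negarg hg (eC_ne _) (cc_m τ m)) 1
  refine QP_order h (2 * m + 1) (eC_ne _) (by convert hp using 1; push_cast; ring) ?_ u
  rw [natCast_le_analyticOrderAt_iff_iteratedDeriv_eq_zero (hp.1.analyticAt 0)]
  intro i hi'
  rw [iter_pm hg.1]
  rcases Nat.even_or_odd' i with ⟨j, rfl | rfl⟩
  · rw [hi j (by omega), mul_zero]
  · rw [pow_succ]; simp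

lemma TS1 {τ : ℂ} (h : 0 < τ.im) {g : ℂ → ℂ} (hg : QP τ (eC (-(1 : ℕ) * τ)) (2 * (1 : ℕ)) g)
    (hi : ∀ i, (i = 0 ∨ i = 2) → iteratedDeriv i g 0 = 0) (u : ℂ) : g u = 0 := by
  have h1 := even_part h hg (fun i hi' => by
    interval_cases i
    · exact hi 0 (by simp)
    · exact hi 2 (by simp)) u
  have h2 := qodd_one h (QP_add hg (QP_negarg hg (eC_ne _) (cc_m τ 1)) (-1))
    (fun u => by simp only [neg_neg]; ring) u
  linear_combination (h1 + h2) / 2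

lemma TS2 {τ : ℂ} (h : 0 < τ.im) {g : ℂ → ℂ} (hg : QP τ (eC (-(2 : ℕ) * τ)) (2 * (2 : ℕ)) g)
    (hi : ∀ i, (i = 0 ∨ i = 1 ∨ i = 2 ∨ i = 4) → iteratedDeriv i g 0 = 0) (u : ℂ) : g u = 0 := by
  have h1 := even_part h hg (fun i hi' => by
    interval_cases i
    · exact hi 0 (by simp)
    · exact hi 2 (by simp)
    · exact hi 4 (by simp)) u
  have h2 := qodd_two h (QP_add hg (QP_negarg hg (eC_ne _) (cc_m τ 2)) (-1))
    (fun u => by simp only [neg_neg]; ring) (by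
      have := iter_pm hg.1 (-1) 1
      rw [hi 1 (by simp), mul_zero, iteratedDeriv_one] at this
      exact this) u
  linear_combination (h1 + h2) / 2

lemma fd_bound {F : ℂ × ℂ → ℂ} (hF : Differentiable ℂ F) {M : ℝ} (hM : 0 ≤ M) (y : ℂ × ℂ)
    (hb : ∀ x ∈ Metric.closedBall y 1, ‖F x‖ ≤ M) : ‖fderiv ℂ F y‖ ≤ M := by
  refine ContinuousLinearMap.opNorm_le_bound _ hM fun v => ?_
  by_cases hv : v = 0
  · simp [hv]
  have hv' : 0 < ‖v‖ := norm_pos_iff.2 hv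
  have hl : Differentiable ℂ (fun t : ℂ => F (y + t • v)) := by fun_prop
  have hd : HasDerivAt (fun t : ℂ => F (y + t • v)) (fderiv ℂ F y v) 0 := by
    have h1 : HasDerivAt (fun t : ℂ => y + t • v) v 0 := by
      simpa using ((hasDerivAt_id (0 : ℂ)).smul_const v).const_add y
    have h2 : HasFDerivAt F (fderiv ℂ F y) (y + (0 : ℂ) • v) := by
      simpa using (hF y).hasFDerivAt
    exact h2.comp_hasDerivAt 0 h1
  have := Complex.norm_deriv_le_of_forall_mem_sphere_norm_le (c := 0) (R := ‖v‖⁻¹) (C := M)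
    (by positivity) hl.diffContOnCl (fun z hz => hb _ (by
      have : ‖z‖ = ‖v‖⁻¹ := by simpa using hz
      simp [norm_smul, this, hv'.ne']))
  rw [hd.deriv] at this
  simpa using this

/-- directional derivative -/
def Dd (e : ℂ × ℂ) (F : ℂ × ℂ → ℂ) : ℂ × ℂ → ℂ := fun x => fderiv ℂ F x e

lemma line_deriv {F : ℂ × ℂ → ℂ} (hF : Differentiable ℂ F) (x e : ℂ × ℂ) :
    HasDerivAt (fun t : ℂ => F (x + t • e)) (Dd e F x) 0 := by
  have h1 : HasDerivAt (fun t : ℂ => x + t • e) e 0 := by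
    simpa using ((hasDerivAt_id (0 : ℂ)).smul_const e).const_add x
  have h2 : HasFDerivAt F (fderiv ℂ F x) (x + (0 : ℂ) • e) := by
    simpa using (hF x).hasFDerivAt
  exact h2.comp_hasDerivAt 0 h1

lemma Dd_diff1 {F : ℂ × ℂ → ℂ} (hF : Differentiable ℂ F) (e : ℂ × ℂ) (he : ‖e‖ ≤ 1) :
    Differentiable ℂ (Dd e F) := by
  intro x₀
  set c : ℝ → ℂ := fun θ => deriv (circleMap 0 1) θ * ((circleMap 0 1 θ) ^ 2)⁻¹ with hc
  have hcn : ∀ θ, ‖c θ‖ = 1 := by intro θ; simp [hc]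
  have hcc : Continuous c := by
    simp only [hc, deriv_circleMap]
    refine (by fun_prop : Continuous fun θ => circleMap 0 1 θ * I).mul
      (Continuous.inv₀ (by fun_prop) ?_)
    intro θ; simp
  have form : ∀ x, Dd e F x = (2 * Real.pi * I : ℂ)⁻¹ •
      ∫ θ in (0)..(2 * Real.pi), c θ • F (x + circleMap 0 1 θ • e) := by
    intro x
    rw [← (line_deriv hF x e).deriv]
    have hl : Differentiable ℂ (fun t : ℂ => F (x + t • e)) := by fun_prop
    rw [← Complex.two_pi_I_inv_smul_circleIntegral_sub_sq_inv_smul_of_differentiable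
      (U := Set.univ) (c := 0) (R := 1) isOpen_univ (Set.subset_univ _) hl.differentiableOn (by simp)]
    simp only [circleIntegral, hc, smul_eq_mul, sub_zero, mul_assoc]
  obtain ⟨M, hM⟩ := (isCompact_closedBall x₀ (3 : ℝ)).exists_bound_of_continuousOn
    hF.continuous.continuousOn
  have hM0 : 0 ≤ M := (norm_nonneg _).trans (hM x₀ (by simp))
  have hpt : ∀ x ∈ Metric.ball x₀ 1, ∀ θ : ℝ,
      ‖fderiv ℂ F (x + circleMap 0 1 θ • e)‖ ≤ M := by
    intro x hx θ
    refine fd_bound hF hM0 _ fun y hy => hM y ?_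
    rw [Metric.mem_closedBall, dist_eq_norm] at hy ⊢
    rw [Metric.mem_ball, dist_eq_norm] at hx
    have h1 : ‖circleMap 0 1 θ • e‖ ≤ 1 := by rw [norm_smul]; simpa using he
    calc ‖y - x₀‖ = ‖(y - (x + circleMap 0 1 θ • e)) + (x - x₀) + circleMap 0 1 θ • e‖ := by
          congr 1; abel
      _ ≤ _ := norm_add₃_le
      _ ≤ 3 := by linarith
  have key := intervalIntegral.hasFDerivAt_integral_of_dominated_of_fderiv_le (𝕜 := ℂ)
    (μ := MeasureTheory.volume) (a := 0) (b := 2 * Real.pi) (bound := fun _ => M)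
    (F := fun x θ => c θ • F (x + circleMap 0 1 θ • e))
    (F' := fun x θ => c θ • fderiv ℂ F (x + circleMap 0 1 θ • e)) (x₀ := x₀)
    (s := Metric.ball x₀ 1) (Metric.ball_mem_nhds _ one_pos)
    (Filter.Eventually.of_forall fun x => by
      have hFc := hF.continuous
      exact Continuous.aestronglyMeasurable (by fun_prop))
    (by
      have hFc := hF.continuous
      exact Continuous.intervalIntegrable (by fun_prop) _ _)
    (by
      have h1 : Measurable (fun θ => fderiv ℂ F (x₀ + circleMap 0 1 θ • e)) :=
        (measurable_fderiv ℂ F).comp (Continuous.measurable (by fun_prop))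
      exact (hcc.measurable.smul h1).aestronglyMeasurable)
    (Filter.Eventually.of_forall fun θ _ x hx => by
      rw [norm_smul, hcn, one_mul]; exact hpt x hx θ)
    (by simp)
    (Filter.Eventually.of_forall fun θ _ x hx => by
      have h2 : HasFDerivAt F (fderiv ℂ F (x + circleMap 0 1 θ • e)) (x + circleMap 0 1 θ • e) :=
        (hF _).hasFDerivAt
      have h3 := h2.comp x ((hasFDerivAt_id x).add_const (circleMap 0 1 θ • e))
      exact h3.const_smul (c θ))
  have : Dd e F = fun x => (2 * Real.pi * I : ℂ)⁻¹ •
      ∫ θ in (0)..(2 * Real.pi), c θ • F (x + circleMap 0 1 θ • e) := funext form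
  rw [this]
  exact key.differentiableAt.const_smul ((2 * Real.pi * I : ℂ)⁻¹)

abbrev d1 : (ℂ × ℂ → ℂ) → ℂ × ℂ → ℂ := Dd (1, 0)
abbrev d2 : (ℂ × ℂ → ℂ) → ℂ × ℂ → ℂ := Dd (0, 1)

lemma Dd_lin (F : ℂ × ℂ → ℂ) (a b : ℂ) (x : ℂ × ℂ) :
    Dd (a, b) F x = a * d1 F x + b * d2 F x := by
  simp only [Dd]
  have : ((a, b) : ℂ × ℂ) = a • (1, 0) + b • (0, 1) := by simp
  rw [this, map_add, map_smul, map_smul]; simp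

lemma d1_diff {F : ℂ × ℂ → ℂ} (hF : Differentiable ℂ F) : Differentiable ℂ (d1 F) :=
  Dd_diff1 hF _ (by simp [Prod.norm_def])

lemma d2_diff {F : ℂ × ℂ → ℂ} (hF : Differentiable ℂ F) : Differentiable ℂ (d2 F) :=
  Dd_diff1 hF _ (by simp [Prod.norm_def])

lemma Dd_diff {F : ℂ × ℂ → ℂ} (hF : Differentiable ℂ F) (e : ℂ × ℂ) :
    Differentiable ℂ (Dd e F) := by
  have : Dd e F = fun x => e.1 * d1 F x + e.2 * d2 F x := funext fun x => Dd_lin F e.1 e.2 x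
  rw [this]
  have h1 := d1_diff hF
  have h2 := d2_diff hF
  fun_prop

lemma Dd_comm {F : ℂ × ℂ → ℂ} (hF : Differentiable ℂ F) : d2 (d1 F) = d1 (d2 F) := by
  have h1 := d1_diff hF
  have h2 := d2_diff hF
  have e : fderiv ℂ F = fun x => d1 F x • ContinuousLinearMap.fst ℂ ℂ ℂ
      + d2 F x • ContinuousLinearMap.snd ℂ ℂ ℂ := by
    funext x
    ext <;> simp [Dd]
  have hd : Differentiable ℂ (fderiv ℂ F) := by rw [e]; fun_prop
  funext x
  have := second_derivative_symmetric (fun y => (hF y).hasFDerivAt) (hd x).hasFDerivAt (0, 1) (1, 0)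
  have g : ∀ e v : ℂ × ℂ, fderiv ℂ (fderiv ℂ F) x v e = Dd v (Dd e F) x := by
    intro e v
    have h3 := (hd x).hasFDerivAt.clm_apply (hasFDerivAt_const e x)
    show _ = fderiv ℂ (fun y => fderiv ℂ F y e) x v
    rw [h3.fderiv]
    simp
  rw [g, g] at this
  exact this

/-- all derivatives up to order `B` vanish at the origin -/
def KV : ℕ → (ℂ × ℂ → ℂ) → Prop
  | 0, F => F 0 = 0
  | B + 1, F => F 0 = 0 ∧ KV B (d1 F) ∧ KV B (d2 F)

lemma KV_zero {B : ℕ} {F : ℂ × ℂ → ℂ} (h : KV B F) : F 0 = 0 := by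
  cases B with
  | zero => exact h
  | succ B => exact h.1

lemma Dd_add {F G : ℂ × ℂ → ℂ} (hF : Differentiable ℂ F) (hG : Differentiable ℂ G) (a b : ℂ)
    (e : ℂ × ℂ) : Dd e (fun x => a * F x + b * G x) = fun x => a * Dd e F x + b * Dd e G x := by
  funext x
  have := (((hF x).hasFDerivAt.const_mul a).add ((hG x).hasFDerivAt.const_mul b)).fderiv
  have e2 : (fun x => a * F x + b * G x) = ((fun x => a * F x) + fun x => b * G x) := rfl
  simp only [Dd]
  rw [e2, this]; simp

lemma KV_lin (B : ℕ) : ∀ {F G : ℂ × ℂ → ℂ} (_ : Differentiable ℂ F) (_ : Differentiable ℂ G)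
    (a b : ℂ), KV B F → KV B G → KV B (fun x => a * F x + b * G x) := by
  induction B with
  | zero => intro F G _ _ a b h1 h2; simp only [KV] at *; simp [h1, h2]
  | succ B ih =>
    intro F G hF hG a b h1 h2
    refine ⟨by simp [h1.1, h2.1], ?_, ?_⟩
    · rw [d1, Dd_add hF hG]; exact ih (d1_diff hF) (d1_diff hG) a b h1.2.1 h2.2.1
    · rw [d2, Dd_add hF hG]; exact ih (d2_diff hF) (d2_diff hG) a b h1.2.2 h2.2.2

lemma KV_Dd {B : ℕ} {F : ℂ × ℂ → ℂ} (hF : Differentiable ℂ F) (h : KV (B + 1) F) (e : ℂ × ℂ) :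
    KV B (Dd e F) := by
  have : Dd e F = fun x => e.1 * d1 F x + e.2 * d2 F x := funext fun x => Dd_lin F e.1 e.2 x
  rw [this]
  exact KV_lin B (d1_diff hF) (d2_diff hF) _ _ h.2.1 h.2.2

lemma Dd_iter_diff {F : ℂ × ℂ → ℂ} (hF : Differentiable ℂ F) (e : ℂ × ℂ) (n : ℕ) :
    Differentiable ℂ ((Dd e)^[n] F) := by
  induction n with
  | zero => exact hF
  | succ n ih => rw [Function.iterate_succ_apply']; exact Dd_diff ih e

lemma KV_iter {F : ℂ × ℂ → ℂ} (hF : Differentiable ℂ F) (e : ℂ × ℂ) (n : ℕ) : ∀ {B : ℕ},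
    KV (B + n) F → KV B ((Dd e)^[n] F) := by
  induction n with
  | zero => intro B h; exact h
  | succ n ih =>
    intro B h
    rw [Function.iterate_succ_apply']
    refine KV_Dd (Dd_iter_diff hF e n) (ih (B := B + 1) ?_) e
    convert h using 1; omega

lemma d2_iter_d1 {F : ℂ × ℂ → ℂ} (hF : Differentiable ℂ F) (n : ℕ) :
    d2^[n] (d1 F) = d1 (d2^[n] F) := by
  induction n with
  | zero => rfl
  | succ n ih =>
    rw [Function.iterate_succ_apply', Function.iterate_succ_apply', ih,
      Dd_comm (Dd_iter_diff hF _ n)]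

lemma KV_of (B : ℕ) : ∀ {F : ℂ × ℂ → ℂ} (_ : Differentiable ℂ F),
    (∀ α β, α + β ≤ B → d1^[α] (d2^[β] F) 0 = 0) → KV B F := by
  induction B with
  | zero => intro F _ h; exact h 0 0 (by simp)
  | succ B ih =>
    intro F hF h
    refine ⟨h 0 0 (by simp), ih (d1_diff hF) ?_, ih (d2_diff hF) ?_⟩
    · intro α β hab
      rw [d2_iter_d1 hF, ← Function.iterate_succ_apply]
      exact h (α + 1) β (by omega)
    · intro α β hab
      rw [← Function.iterate_succ_apply]
      exact h α (β + 1) (by omega)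

lemma Dd_comp {F : ℂ × ℂ → ℂ} (hF : Differentiable ℂ F) (L : ℂ × ℂ →L[ℂ] ℂ × ℂ) (e : ℂ × ℂ) :
    Dd e (F ∘ L) = Dd (L e) F ∘ L := by
  funext x
  simp only [Dd, Function.comp]
  have : HasFDerivAt (F ∘ L) ((fderiv ℂ F (L x)).comp L) x :=
    (hF (L x)).hasFDerivAt.comp x L.hasFDerivAt
  have h2 := this.fderiv
  show fderiv ℂ (F ∘ L) x e = _
  rw [h2]; rfl

lemma Dd_comp_iter {F : ℂ × ℂ → ℂ} (hF : Differentiable ℂ F) (L : ℂ × ℂ →L[ℂ] ℂ × ℂ) (e : ℂ × ℂ)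
    (n : ℕ) : (Dd e)^[n] (F ∘ L) = (Dd (L e))^[n] F ∘ L := by
  induction n with
  | zero => rfl
  | succ n ih =>
    rw [Function.iterate_succ_apply', ih, Dd_comp (Dd_iter_diff hF _ n),
      Function.iterate_succ_apply']

lemma slice1 {F : ℂ × ℂ → ℂ} (hF : Differentiable ℂ F) (n : ℕ) (v : ℂ) :
    iteratedDeriv n (fun u => F (u, v)) = fun u => d1^[n] F (u, v) := by
  induction n with
  | zero => simp
  | succ n ih =>
    rw [iteratedDeriv_succ, ih, Function.iterate_succ_apply']
    funext u
    have h1 : HasDerivAt (fun u : ℂ => (u, v)) ((1, 0) : ℂ × ℂ) u :=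
      (hasDerivAt_id u).prodMk (hasDerivAt_const u v)
    exact ((Dd_iter_diff hF (1, 0) n (u, v)).hasFDerivAt.comp_hasDerivAt u h1).deriv

lemma slice2 {F : ℂ × ℂ → ℂ} (hF : Differentiable ℂ F) (n : ℕ) (u : ℂ) :
    iteratedDeriv n (fun v => F (u, v)) = fun v => d2^[n] F (u, v) := by
  induction n with
  | zero => simp
  | succ n ih =>
    rw [iteratedDeriv_succ, ih, Function.iterate_succ_apply']
    funext v
    have h1 : HasDerivAt (fun v : ℂ => (u, v)) ((0, 1) : ℂ × ℂ) v :=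
      (hasDerivAt_const v u).prodMk (hasDerivAt_id v)
    exact ((Dd_iter_diff hF (0, 1) n (u, v)).hasFDerivAt.comp_hasDerivAt v h1).deriv

lemma slice12 {F : ℂ × ℂ → ℂ} (hF : Differentiable ℂ F) (i j : ℕ) :
    iteratedDeriv i (fun u => iteratedDeriv j (fun v => F (u, v)) 0) 0 = d1^[i] (d2^[j] F) 0 := by
  simp only [slice2 hF]
  rw [slice1 (Dd_iter_diff hF (0, 1) j)]; rfl

lemma Dd_neg (e : ℂ × ℂ) (F : ℂ × ℂ → ℂ) : Dd e (-F) = -Dd e F := by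
  funext x
  simp only [Dd, Pi.neg_apply]
  rw [fderiv_neg]; rfl

lemma Dd_neg_dir (e : ℂ × ℂ) (F : ℂ × ℂ → ℂ) : Dd (-e) F = -Dd e F := by
  funext x
  simp [Dd]

lemma Dd_iter_neg (e : ℂ × ℂ) (F : ℂ × ℂ → ℂ) (n : ℕ) :
    (Dd e)^[n] (-F) = -(Dd e)^[n] F := by
  induction n with
  | zero => rfl
  | succ n ih => rw [Function.iterate_succ_apply', Function.iterate_succ_apply', ih, Dd_neg]

lemma Dd_neg_two (e : ℂ × ℂ) (n : ℕ) : (Dd (-e))^[2 * n] = (Dd e)^[2 * n] := by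
  rw [Function.iterate_mul, Function.iterate_mul]
  congr 1
  funext F
  show Dd (-e) (Dd (-e) F) = Dd e (Dd e F)
  rw [Dd_neg_dir, Dd_neg_dir, Dd_neg, neg_neg]

lemma core {S : ℕ → Prop} {τ C : ℂ} {n : ℤ}
    (TS : ∀ g, QP τ C n g → (∀ i, S i → iteratedDeriv i g 0 = 0) → ∀ u, g u = 0)
    {f : ℂ × ℂ → ℂ} (hf : Differentiable ℂ f)
    (h1 : ∀ u v, f (u + 1, v) = f (u, v)) (h2 : ∀ u v, f (u + τ, v) = C * eC (-n * u) * f (u, v))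
    (h3 : ∀ u v, f (u, v + 1) = f (u, v)) (h4 : ∀ u v, f (u, v + τ) = C * eC (-n * v) * f (u, v))
    (hD : ∀ i j, S i → S j → d1^[i] (d2^[j] f) 0 = 0) (u v : ℂ) : f (u, v) = 0 := by
  have hg : ∀ j, S j → ∀ u, iteratedDeriv j (fun v => f (u, v)) 0 = 0 := by
    intro j hj
    refine TS _ ⟨?_, ?_, ?_⟩ ?_
    · simp only [slice2 hf]
      have := Dd_iter_diff hf (0, 1) j
      fun_prop
    · intro u; simp only [h1]
    · intro u; simp only [h2]
      rw [iteratedDeriv_const_mul_field]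
    · intro i hi
      rw [slice12 hf]; exact hD i j hi hj
  refine TS (fun v => f (u, v)) ⟨by fun_prop, fun v => h3 u v, fun v => h4 u v⟩ (fun j hj => hg j hj u) v

/-- change of coordinates -/
def LL : ℂ × ℂ →L[ℂ] ℂ × ℂ :=
  (ContinuousLinearMap.fst ℂ ℂ ℂ + I • ContinuousLinearMap.snd ℂ ℂ ℂ).prod
    (ContinuousLinearMap.fst ℂ ℂ ℂ - I • ContinuousLinearMap.snd ℂ ℂ ℂ)

lemma LL_apply (u v : ℂ) : LL (u, v) = (u + I * v, u - I * v) := by simp [LL]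

/-- rotation -/
def RR : ℂ × ℂ →L[ℂ] ℂ × ℂ :=
  (-ContinuousLinearMap.snd ℂ ℂ ℂ).prod (ContinuousLinearMap.fst ℂ ℂ ℂ)

lemma RR_apply (u v : ℂ) : RR (u, v) = (-v, u) := by simp [RR]

lemma D_low {B : ℕ} {F : ℂ × ℂ → ℂ} (hF : Differentiable ℂ F) (h : KV B F) {i j : ℕ}
    (hij : i + j ≤ B) : d1^[i] (d2^[j] (F ∘ LL)) 0 = 0 := by
  rw [d2, d1, Dd_comp_iter hF, Dd_comp_iter (Dd_iter_diff hF _ j)]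
  have h1 : KV ((B - j) + j) F := by convert h using 1; omega
  have h2 := KV_iter hF (LL (0, 1)) j h1
  have h3 : KV ((B - j - i) + i) ((Dd (LL (0, 1)))^[j] F) := by convert h2 using 1; omega
  have := KV_zero (KV_iter (Dd_iter_diff hF _ j) (LL (1, 0)) i h3)
  simpa using this

lemma odd_even {f : ℂ × ℂ → ℂ} (hf : Differentiable ℂ f) (h : ∀ u v, f (-u, -v) = -f (u, v))
    (i j : ℕ) : d1^[2 * i] (d2^[2 * j] f) 0 = 0 := by
  have h1 : f ∘ (-ContinuousLinearMap.id ℂ (ℂ × ℂ)) = -f := by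
    funext x; obtain ⟨u, v⟩ := x
    simpa using h u v
  have h2 := congrArg (fun G => d1^[2 * i] (d2^[2 * j] G) 0) h1
  simp only [d2, d1] at h2
  rw [Dd_comp_iter hf, Dd_comp_iter (Dd_iter_diff hf _ _), Dd_iter_neg, Dd_iter_neg] at h2
  have e1 : ∀ e : ℂ × ℂ, (-ContinuousLinearMap.id ℂ (ℂ × ℂ)) e = -e := fun e => by simp
  rw [e1, e1, Dd_neg_two, Dd_neg_two] at h2
  simp only [Function.comp, map_zero, Pi.neg_apply] at h2
  exact self_eq_neg.1 h2

lemma rot_zero {f : ℂ × ℂ → ℂ} (hf : Differentiable ℂ f) (h : ∀ u v, f (-v, u) = -f (u, v)) :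
    d1^[2] (d2^[2] f) 0 = 0 := by
  have h1 : f ∘ RR = -f := by
    funext x; obtain ⟨u, v⟩ := x
    simpa [RR_apply] using h u v
  have h2 := congrArg (fun G => d1^[2] (d2^[2] G) 0) h1
  simp only [d2, d1] at h2
  rw [Dd_comp_iter hf, Dd_comp_iter (Dd_iter_diff hf _ _), Dd_iter_neg, Dd_iter_neg] at h2
  have e1 : RR (0, 1) = -(1, 0) := by simp [RR_apply]
  have e2 : RR (1, 0) = (0, 1) := by simp [RR_apply]
  rw [e1, e2] at h2
  have e3 := Dd_neg_two (1, 0) 1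
  rw [mul_one] at e3
  rw [e3] at h2
  have e4 : d2^[2] (d1^[2] f) = d1^[2] (d2^[2] f) := by
    show d2^[2] (d1 (d1 f)) = d1 (d1 (d2^[2] f))
    rw [d2_iter_d1 (d1_diff hf), d2_iter_d1 hf]
  rw [d1, d2] at e4
  rw [e4] at h2
  simp only [Function.comp, map_zero, Pi.neg_apply] at h2
  exact self_eq_neg.1 h2

lemma F_diff {k m : ℕ} {φ : ℂ → ℂ → ℂ → ℂ} (h : IsHJF k m φ) {τ : ℂ} (hτ : UHP τ) :
    Differentiable ℂ (fun p : ℂ × ℂ => φ τ p.1 p.2) := by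
  intro p
  have ho : IsOpen {p : ℂ × ℂ × ℂ | UHP p.1} :=
    isOpen_lt continuous_const (Complex.continuous_im.comp continuous_fst)
  have h1 := (h.holo (τ, p) hτ).differentiableAt (ho.mem_nhds hτ)
  exact h1.comp p (g := fun p : ℂ × ℂ × ℂ => φ p.1 p.2.1 p.2.2) (f := fun p : ℂ × ℂ => (τ, p))
    (by fun_prop)

lemma unit_law {k m : ℕ} {φ : ℂ → ℂ → ℂ → ℂ} (h : IsHJF k m φ) {τ : ℂ} (hτ : UHP τ) {ε : ℂ}
    (hε : ε ∈ ({1, -1, Complex.I, -Complex.I} : Set ℂ)) (z w : ℂ) :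
    φ τ (ε * z) ((starRingEnd ℂ) ε * w) = ε ^ k * φ τ z w := by
  have := h.transf ε hε 1 τ z w hτ
  simpa [Ma, Mb, Mc, Md, eC] using this

lemma master {k m : ℕ} {φ : ℂ → ℂ → ℂ → ℂ} (h : IsHJF k m φ) {S : ℕ → Prop} {B : ℕ}
    (TS : ∀ τ g, 0 < τ.im → QP τ (eC (-(m : ℕ) * τ)) (2 * (m : ℕ)) g →
      (∀ i, S i → iteratedDeriv i g 0 = 0) → ∀ u, g u = 0)
    (hbad : ∀ f : ℂ × ℂ → ℂ, Differentiable ℂ f → (∀ u v, f (-u, -v) = (-1) ^ k * f (u, v)) →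
      (∀ u v, f (-v, u) = I ^ k * f (u, v)) →
      ∀ i j, S i → S j → i + j ≤ B ∨ d1^[i] (d2^[j] f) 0 = 0)
    (hne : ∃ τ z₁ z₂ : ℂ, UHP τ ∧ φ τ z₁ z₂ ≠ 0) :
    ∃ α β : ℕ, α + β ≤ B ∧ ∃ τ : ℂ, UHP τ ∧ chiHJF φ α β τ ≠ 0 := by
  obtain ⟨τ, z, w, hτ, hz⟩ := hne
  by_contra hcon
  push Not at hcon
  apply hz
  set F : ℂ × ℂ → ℂ := fun p => φ τ p.1 p.2 with hFdef
  have hF : Differentiable ℂ F := F_diff h hτ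
  have hKV : KV B F := by
    refine KV_of B hF fun α β hab => ?_
    have h1 := hcon α β hab τ hτ
    rw [← slice12 hF]
    simp only [chiHJF] at h1
    rcases mul_eq_zero.1 h1 with h2 | h2
    · exfalso
      have a1 : (α.factorial : ℂ) ≠ 0 := by exact_mod_cast α.factorial_ne_zero
      have a2 : (β.factorial : ℂ) ≠ 0 := by exact_mod_cast β.factorial_ne_zero
      exact (one_div_ne_zero (mul_ne_zero a1 a2)) h2
    · exact h2
  have hf : Differentiable ℂ (F ∘ LL) := hF.comp LL.differentiable
  have hfa : ∀ u v, (F ∘ LL) (u, v) = φ τ (u + I * v) (u - I * v) := by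
    intro u v; simp [LL_apply, hFdef]
  have hz0 := core (S := S) (τ := τ) (TS τ · hτ) hf ?_ ?_ ?_ ?_ ?_ ((z + w) / 2) ((z - w) / (2 * I))
  · rw [hfa] at hz0
    have hI := I_ne_zero
    have e1 : (z + w) / 2 + I * ((z - w) / (2 * I)) = z := by field_simp; ring
    have e2 : (z + w) / 2 - I * ((z - w) / (2 * I)) = w := by field_simp; ring
    rwa [e1, e2] at hz0
  · intro u v
    rw [hfa, hfa]
    have := h.ellip 0 0 1 0 τ (u + I * v) (u - I * v) hτ
    have e0 : eC 0 = 1 := by simp [eC]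
    simp only [Int.cast_zero, Int.cast_one, zero_mul, add_zero, sub_zero] at this
    norm_num [e0] at this
    rw [← this]; congr 1 <;> ring
  · intro u v
    rw [hfa, hfa, ← eC_add]
    have := h.ellip 1 0 0 0 τ (u + I * v) (u - I * v) hτ
    convert this using 2
    · push_cast; ring
    · push_cast; ring
    · congr 1; push_cast; ring
  · intro u v
    rw [hfa, hfa]
    have := h.ellip 0 0 0 1 τ (u + I * v) (u - I * v) hτ
    have e0 : eC 0 = 1 := by simp [eC]
    norm_num [e0] at this
    rw [← this]; congr 1 <;> ring
  · intro u v
    rw [hfa, hfa, ← eC_add]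
    have := h.ellip 0 1 0 0 τ (u + I * v) (u - I * v) hτ
    convert this using 2
    · push_cast; ring
    · push_cast; ring
    · congr 1; push_cast; linear_combination (-2 * (m : ℂ) * v) * I_sq
  · intro i j hi hj
    have hb1 : ∀ u v, (F ∘ LL) (-u, -v) = (-1) ^ k * (F ∘ LL) (u, v) := by
      intro u v
      rw [hfa, hfa, ← unit_law h hτ (by simp)]
      congr 1
      · ring
      · simp; ring
    have hb2 : ∀ u v, (F ∘ LL) (-v, u) = I ^ k * (F ∘ LL) (u, v) := by
      intro u v
      rw [hfa, hfa, ← unit_law h hτ (by simp)]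
      congr 1
      · linear_combination (-v) * I_sq
      · simp; linear_combination (-v) * I_sq
    rcases hbad (F ∘ LL) hf hb1 hb2 i j hi hj with h1 | h1
    · exact D_low hF hKV h1
    · exact h1

theorem stmt18 (k : ℕ) (hk : 0 < k) :
    (∀ φ : ℂ → ℂ → ℂ → ℂ, IsHJF k 1 φ →
      (∃ τ z₁ z₂ : ℂ, UHP τ ∧ φ τ z₁ z₂ ≠ 0) →
      (k % 4 = 2 → ∃ α β : ℕ, α + β ≤ 2 ∧ ∃ τ : ℂ, UHP τ ∧ chiHJF φ α β τ ≠ 0) ∧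
      (k % 4 = 0 → ∃ α β : ℕ, α + β ≤ 4 ∧ ∃ τ : ℂ, UHP τ ∧ chiHJF φ α β τ ≠ 0)) ∧
    (∀ φ : ℂ → ℂ → ℂ → ℂ, IsHJF k 2 φ →
      (∃ τ z₁ z₂ : ℂ, UHP τ ∧ φ τ z₁ z₂ ≠ 0) →
      ((k % 4 = 1 ∨ k % 4 = 3) →
        ∃ α β : ℕ, α + β ≤ 5 ∧ ∃ τ : ℂ, UHP τ ∧ chiHJF φ α β τ ≠ 0) ∧
      ((k % 4 = 0 ∨ k % 4 = 2) →
        ∃ α β : ℕ, α + β ≤ 8 ∧ ∃ τ : ℂ, UHP τ ∧ chiHJF φ α β τ ≠ 0)) := by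
  refine ⟨fun φ h hne => ⟨fun hk4 => ?_, fun _ => ?_⟩, fun φ h hne => ⟨fun hk4 => ?_, fun _ => ?_⟩⟩
  · refine master h (S := fun i => i = 0 ∨ i = 2) (fun τ g hτ hg hi u => TS1 hτ hg hi u) ?_ hne
    intro f hf _ hrot i j hi hj
    have hIk : I ^ k = -1 := by
      rw [← Nat.div_add_mod k 4, hk4, pow_add, pow_mul, I_pow_four, one_pow, one_mul, I_sq]
    simp only [hIk, neg_one_mul] at hrot
    rcases hi with rfl | rfl <;> rcases hj with rfl | rfl
    · left; norm_num
    · left; norm_num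
    · left; norm_num
    · right; exact rot_zero hf hrot
  · refine master h (S := fun i => i = 0 ∨ i = 2) (fun τ g hτ hg hi u => TS1 hτ hg hi u) ?_ hne
    intro f _ _ _ i j hi hj
    left; omega
  · refine master h (S := fun i => i = 0 ∨ i = 1 ∨ i = 2 ∨ i = 4)
      (fun τ g hτ hg hi u => TS2 hτ hg hi u) ?_ hne
    intro f hf hneg _ i j hi hj
    have hodd : Odd k := by rw [Nat.odd_iff]; omega
    simp only [hodd.neg_one_pow, neg_one_mul] at hneg
    by_cases hij : i + j ≤ 5
    · exact Or.inl hij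
    right
    obtain ⟨a, rfl⟩ : ∃ a, i = 2 * a := ⟨i / 2, by omega⟩
    obtain ⟨b, rfl⟩ : ∃ b, j = 2 * b := ⟨j / 2, by omega⟩
    exact odd_even hf hneg a b
  · refine master h (S := fun i => i = 0 ∨ i = 1 ∨ i = 2 ∨ i = 4)
      (fun τ g hτ hg hi u => TS2 hτ hg hi u) ?_ hne
    intro f _ _ _ i j hi hj
    left; omega
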